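/- Let α, β, γ ≥ 0 with α + β + γ ≥ 1, with strict inequality if at least one of α, β, γ equals 1. Then the bilinear map B(u₁,u₂) = Δ(∇u₁ · ∇u₂) maps H^{1+α} × H^{1+β} continuously into H^{-2-γ} on the two-dimensional torus: there exists a constant c = c(α,β,γ) such that ‖B(u₁,u₂)‖_{H^{-2-γ}} ≤ c ‖u₁‖_{H^{1+α}} ‖u₂‖_{H^{1+β}}. -/

import Mathlib

open scoped ENNReal

/-- Euclidean norm of a lattice point in `ℤ²`. -/
noncomputable def latNorm (m : ℤ × ℤ) : ℝ :=
  Real.sqrt ((m.1 : ℝ)^2 + (m.2 : ℝ)^2)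

/-- The `H^s` norm of a function on the torus `𝕋²`, given through its Fourier
coefficients `u : ℤ × ℤ → ℂ`. -/
noncomputable def HNorm (s : ℝ) (u : ℤ × ℤ → ℂ) : ℝ≥0∞ :=
  (∑' k : ℤ × ℤ, ENNReal.ofReal ((1 + latNorm k ^ 2) ^ s * ‖u k‖ ^ 2)) ^ (1/2 : ℝ)

/-- Fourier coefficients of the bilinear operator `B(u₁,u₂) = Δ(∇u₁ · ∇u₂)`:
`B(u₁,u₂)_k = -|k|² ∑_{m+n=k} (m·n) (u₁)_m (u₂)_n`. -/
noncomputable def Bcoef (u v : ℤ × ℤ → ℂ) (k : ℤ × ℤ) : ℂ :=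
  -((latNorm k ^ 2 : ℝ) : ℂ) *
    ∑' p : {p : (ℤ × ℤ) × (ℤ × ℤ) // p.1 + p.2 = k},
      (((p.1.1.1 : ℝ) * p.1.2.1 + (p.1.1.2 : ℝ) * p.1.2.2 : ℝ) : ℂ) *
        u p.1.1 * v p.1.2

theorem rpow_sub_one_le_sub_rpow {a x : ℝ} (ha0 : 0 ≤ a) (ha1 : a ≤ 1) (hx : 1 ≤ x) :
    a * x ^ (a - 1) ≤ x ^ a - (x - 1) ^ a := by
  have hx0 : 0 < x := by linarith
  have hinv : x⁻¹ ≤ 1 := inv_le_one_of_one_le₀ hx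
  have h := rpow_one_add_le_one_add_mul_self (s := -x⁻¹) (by linarith) ha0 ha1
  have hfac : (x - 1) ^ a = x ^ a * (1 + -x⁻¹) ^ a := by
    rw [← Real.mul_rpow hx0.le (by linarith)]
    congr 1
    field_simp
    ring
  rw [hfac, Real.rpow_sub_one hx0.ne']
  have := mul_le_mul_of_nonneg_left h (Real.rpow_nonneg hx0.le a)
  calc a * (x ^ a / x) = x ^ a - x ^ a * (1 + a * -x⁻¹) := by field_simp; ring
    _ ≤ _ := by linarith

theorem exists_sum_range_rpow_neg_le {a b : ℝ} (ha : 0 ≤ a) (hb : 0 ≤ b) (hab : 1 ≤ a + b)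
    (h1 : b = 1 → 0 < a) :
    ∃ C : ℝ, 0 < C ∧ ∀ M : ℕ,
      ∑ j ∈ Finset.range (M + 1), (1 + j : ℝ) ^ (-b) ≤ C * (1 + M) ^ a := by
  rcases ha.eq_or_lt with rfl | ha
  · have hb1 : 1 < b := lt_of_le_of_ne (by linarith) fun h => (h1 h.symm).false
    have hs : Summable fun j : ℕ => (1 + j : ℝ) ^ (-b) := by
      have := (summable_nat_add_iff 1).2 (Real.summable_nat_rpow.2 (neg_lt_neg hb1))
      simpa [add_comm] using this
    have hnn : ∀ j : ℕ, 0 ≤ (1 + j : ℝ) ^ (-b) := fun j => by positivity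
    refine ⟨∑' j : ℕ, (1 + j : ℝ) ^ (-b), hs.tsum_pos hnn 0 (by simp), fun M => ?_⟩
    simpa using hs.sum_le_tsum _ fun j _ => hnn j
  · set d := min a 1
    have hd0 : 0 < d := lt_min ha one_pos
    have hd1 : d ≤ 1 := min_le_right _ _
    have hdb : -b ≤ d - 1 := by
      rcases min_cases a 1 with h | h <;> simp only [d, h.1] <;> linarith
    refine ⟨d⁻¹, by positivity, fun M => ?_⟩
    suffices h : ∑ j ∈ Finset.range (M + 1), (1 + j : ℝ) ^ (-b) ≤ d⁻¹ * (1 + M) ^ d by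
      refine h.trans ?_
      gcongr
      · linarith [M.cast_nonneg (α := ℝ)]
      · exact min_le_left _ _
    induction M with
    | zero => simpa using one_le_inv_iff₀.2 ⟨hd0, hd1⟩
    | succ M ih =>
      rw [Finset.sum_range_succ]
      have hM : (0 : ℝ) ≤ M := M.cast_nonneg
      have hx : (1 : ℝ) ≤ 1 + (M + 1 : ℕ) := by push_cast; linarith
      have h2 := rpow_sub_one_le_sub_rpow hd0.le hd1 hx
      have h3 : (1 + (M + 1 : ℕ) : ℝ) ^ (-b) ≤ (1 + (M + 1 : ℕ) : ℝ) ^ (d - 1) :=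
        Real.rpow_le_rpow_of_exponent_le hx hdb
      have h4 : (1 + (M + 1 : ℕ) : ℝ) - 1 = 1 + M := by push_cast; ring
      rw [h4] at h2
      have h5 := mul_le_mul_of_nonneg_left h2 (inv_nonneg.2 hd0.le)
      rw [inv_mul_cancel_left₀ hd0.ne'] at h5
      linarith

theorem ENNReal.tsum_int_comp_natAbs_le (f : ℕ → ℝ≥0∞) :
    ∑' j : ℤ, f j.natAbs ≤ 2 * ∑' n, f n := by
  have hs : Function.Surjective (Sum.elim (fun n : ℕ => (n : ℤ)) fun n : ℕ => -(n : ℤ)) := by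
    intro j
    rcases Int.natAbs_eq j with h | h
    · exact ⟨.inl j.natAbs, h.symm⟩
    · exact ⟨.inr j.natAbs, h.symm⟩
  refine (ENNReal.tsum_le_tsum_comp_of_surjective hs _).trans_eq ?_
  rw [ENNReal.summable.tsum_sum ENNReal.summable]
  simp [two_mul]

theorem ENNReal.sq_tsum_mul_le {ι : Type*} (f g : ι → ℝ≥0∞) :
    (∑' i, f i * g i) ^ 2 ≤ (∑' i, f i ^ 2) * ∑' i, g i ^ 2 := by
  have h : ∑' i, f i * g i ≤ ((∑' i, f i ^ 2) * ∑' i, g i ^ 2) ^ (1 / 2 : ℝ) := by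
    rw [ENNReal.tsum_eq_iSup_sum]
    refine iSup_le fun s => (ENNReal.inner_le_Lp_mul_Lq s f g .two_two).trans ?_
    rw [ENNReal.mul_rpow_of_nonneg _ _ (by norm_num)]
    simp only [ENNReal.rpow_two]
    gcongr <;> exact ENNReal.sum_le_tsum s
  calc _ ≤ (((∑' i, f i ^ 2) * ∑' i, g i ^ 2) ^ (1 / 2 : ℝ)) ^ 2 := by gcongr
    _ = _ := by rw [← ENNReal.rpow_two, ← ENNReal.rpow_mul]; norm_num

theorem ENNReal.add_sq_le_four_mul (x y : ℝ≥0∞) : (x + y) ^ 2 ≤ 4 * (x ^ 2 + y ^ 2) := by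
  rcases le_total x y with h | h
  · calc (x + y) ^ 2 ≤ (y + y) ^ 2 := by gcongr
      _ = 4 * y ^ 2 := by ring
      _ ≤ _ := by gcongr; exact le_add_self
  · calc (x + y) ^ 2 ≤ (x + x) ^ 2 := by gcongr
      _ = 4 * x ^ 2 := by ring
      _ ≤ _ := by gcongr; exact le_self_add

theorem latNorm_sq (m : ℤ × ℤ) : latNorm m ^ 2 = (m.1 : ℝ) ^ 2 + (m.2 : ℝ) ^ 2 :=
  Real.sq_sqrt (by positivity)

theorem one_le_one_add_latNorm_sq (m : ℤ × ℤ) : 1 ≤ 1 + latNorm m ^ 2 := by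
  linarith [sq_nonneg (latNorm m)]

theorem one_add_latNorm_sq_pos (m : ℤ × ℤ) : 0 < 1 + latNorm m ^ 2 :=
  one_pos.trans_le (one_le_one_add_latNorm_sq m)

theorem one_add_latNorm_sq_le_add_sub (k m : ℤ × ℤ) :
    1 + latNorm m ^ 2 ≤ 2 * ((1 + latNorm k ^ 2) + (1 + latNorm (k - m) ^ 2)) := by
  simp only [latNorm_sq, Prod.fst_sub, Prod.snd_sub, Int.cast_sub]
  nlinarith [sq_nonneg (2 * (k.1 : ℝ) - m.1), sq_nonneg (2 * (k.2 : ℝ) - m.2)]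

/-- The weight `⟨k⟩^{2s} = (1 + |k|²)^s` of the Sobolev norm, as an extended nonnegative real. -/
noncomputable def sobolevWeight (s : ℝ) (k : ℤ × ℤ) : ℝ≥0∞ :=
  ENNReal.ofReal ((1 + latNorm k ^ 2) ^ s)

theorem sobolevWeight_mul (s t : ℝ) (k : ℤ × ℤ) :
    sobolevWeight s k * sobolevWeight t k = sobolevWeight (s + t) k := by
  have h := one_add_latNorm_sq_pos k
  rw [sobolevWeight, sobolevWeight, sobolevWeight, ← ENNReal.ofReal_mul (by positivity),
    Real.rpow_add h]

theorem sobolevWeight_zero (k : ℤ × ℤ) : sobolevWeight 0 k = 1 := by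
  simp [sobolevWeight]

theorem sobolevWeight_sq (s : ℝ) (k : ℤ × ℤ) :
    sobolevWeight s k ^ 2 = sobolevWeight (2 * s) k := by
  rw [sq, sobolevWeight_mul, two_mul]

theorem sobolevWeight_neg_le {s : ℝ} (hs : 0 ≤ s) {k m : ℤ × ℤ}
    (h : 1 + latNorm m ^ 2 ≤ 4 * (1 + latNorm k ^ 2)) :
    sobolevWeight (-s) k ≤ ENNReal.ofReal (4 ^ s) * sobolevWeight (-s) m := by
  have hk := one_add_latNorm_sq_pos k
  have hm := one_add_latNorm_sq_pos m
  rw [sobolevWeight, sobolevWeight, ← ENNReal.ofReal_mul (by positivity)]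
  refine ENNReal.ofReal_le_ofReal ?_
  rw [Real.rpow_neg hk.le, Real.rpow_neg hm.le, ← div_eq_mul_inv, inv_le_iff_one_le_mul₀'
    (by positivity), mul_div_assoc', ← Real.mul_rpow hk.le (by norm_num), one_le_div (by positivity)]
  exact Real.rpow_le_rpow hm.le (by linarith) hs

theorem sobolevWeight_neg_le_mul {b : ℝ} (hb : 0 ≤ b) (n : ℤ × ℤ) :
    sobolevWeight (-b) n ≤ ENNReal.ofReal (2 ^ b) *
      (ENNReal.ofReal ((1 + n.1.natAbs : ℝ) ^ (-b)) *
        ENNReal.ofReal ((1 + n.2.natAbs : ℝ) ^ (-b))) := by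
  have hn := one_add_latNorm_sq_pos n
  rw [sobolevWeight, ← ENNReal.ofReal_mul (by positivity), ← ENNReal.ofReal_mul (by positivity)]
  refine ENNReal.ofReal_le_ofReal ?_
  have hcast : ∀ j : ℤ, ((j.natAbs : ℝ)) ^ 2 = (j : ℝ) ^ 2 := fun j => by
    rw [Nat.cast_natAbs, Int.cast_abs, sq_abs]
  rw [← Real.mul_rpow (by positivity) (by positivity), Real.rpow_neg hn.le,
    Real.rpow_neg (by positivity), ← div_eq_mul_inv, inv_le_iff_one_le_mul₀' (by positivity),
    mul_div_assoc', ← Real.mul_rpow hn.le (by norm_num), one_le_div (by positivity)]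
  refine Real.rpow_le_rpow (by positivity) ?_ hb
  rw [latNorm_sq, ← hcast, ← hcast]
  nlinarith [sq_nonneg ((n.1.natAbs : ℝ) - 1), sq_nonneg ((n.2.natAbs : ℝ) - 1),
    sq_nonneg ((n.1.natAbs : ℝ) - n.2.natAbs)]

theorem natAbs_le_floor_sqrt {j : ℤ} {R : ℝ} (h : (j : ℝ) ^ 2 ≤ R) : j.natAbs ≤ ⌊√R⌋₊ := by
  refine Nat.le_floor ?_
  rw [Nat.cast_natAbs, Int.cast_abs]
  exact Real.abs_le_sqrt h

/-- Lattice sums of `⟨n⟩^{-2b}` over `⟨n⟩ ≤ ⟨m⟩` grow at most like `⟨m⟩^{2a}` when `a + b ≥ 1`,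
the case `(a, b) = (0, 1)` being excluded. -/
theorem exists_tsum_sobolevWeight_neg_le {a b : ℝ} (ha : 0 ≤ a) (hb : 0 ≤ b) (hab : 1 ≤ a + b)
    (h1 : b = 1 → 0 < a) :
    ∃ C : ℝ, 0 < C ∧ ∀ m : ℤ × ℤ,
      ∑' n : ℤ × ℤ, (if 1 + latNorm n ^ 2 ≤ 1 + latNorm m ^ 2 then sobolevWeight (-b) n else 0) ≤
        ENNReal.ofReal C * sobolevWeight a m := by
  obtain ⟨C, hC, hsum⟩ := exists_sum_range_rpow_neg_le ha hb hab h1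
  refine ⟨2 ^ b * (2 * (C * 2 ^ a)) ^ 2, by positivity, fun m => ?_⟩
  set R := 1 + latNorm m ^ 2 with hR
  have hR1 : 1 ≤ R := one_le_one_add_latNorm_sq m
  set M := ⌊√R⌋₊
  set h : ℕ → ℝ≥0∞ := fun j => if j ≤ M then ENNReal.ofReal ((1 + j : ℝ) ^ (-b)) else 0 with hh
  have hh_sum : ∑' j, h j ≤ ENNReal.ofReal (C * 2 ^ a * R ^ (a / 2)) := by
    rw [tsum_eq_sum (s := Finset.range (M + 1)) fun j hj => if_neg (by simpa using hj)]
    rw [Finset.sum_congr rfl fun j hj => if_pos (Nat.lt_succ_iff.1 (Finset.mem_range.1 hj)),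
      ← ENNReal.ofReal_sum_of_nonneg fun j _ => by positivity]
    refine ENNReal.ofReal_le_ofReal ((hsum M).trans ?_)
    have hM : (M : ℝ) ≤ √R := Nat.floor_le (Real.sqrt_nonneg R)
    have hs1 : 1 ≤ √R := Real.one_le_sqrt.2 hR1
    rw [mul_assoc]
    gcongr
    calc (1 + M : ℝ) ^ a ≤ (2 * √R) ^ a := Real.rpow_le_rpow (by positivity) (by linarith) ha
      _ = 2 ^ a * R ^ (a / 2) := by
        rw [Real.mul_rpow (by norm_num) (by positivity), Real.sqrt_eq_rpow,
          ← Real.rpow_mul (by positivity)]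
        congr 2
        ring
  have hpt : ∀ n : ℤ × ℤ, (if 1 + latNorm n ^ 2 ≤ R then sobolevWeight (-b) n else 0) ≤
      ENNReal.ofReal (2 ^ b) * (h n.1.natAbs * h n.2.natAbs) := fun n => by
    split_ifs with hn
    · rw [latNorm_sq] at hn
      rw [hh]
      simp only
      rw [if_pos (natAbs_le_floor_sqrt (by nlinarith)), if_pos (natAbs_le_floor_sqrt (by nlinarith))]
      exact sobolevWeight_neg_le_mul hb n
    · exact zero_le
  calc _ ≤ ∑' n : ℤ × ℤ, ENNReal.ofReal (2 ^ b) * (h n.1.natAbs * h n.2.natAbs) :=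
        ENNReal.tsum_le_tsum hpt
    _ = ENNReal.ofReal (2 ^ b) * (∑' j : ℤ, h j.natAbs) ^ 2 := by
        rw [ENNReal.tsum_mul_left, ENNReal.tsum_prod']
        simp only [ENNReal.tsum_mul_left, ENNReal.tsum_mul_right, sq]
    _ ≤ ENNReal.ofReal (2 ^ b) * (2 * ENNReal.ofReal (C * 2 ^ a * R ^ (a / 2))) ^ 2 := by
        gcongr
        exact (ENNReal.tsum_int_comp_natAbs_le h).trans (by gcongr)
    _ = _ := by
        have h2 : (2 : ℝ≥0∞) = ENNReal.ofReal 2 := by simp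
        rw [sobolevWeight, h2, ← ENNReal.ofReal_mul (by positivity),
          ← ENNReal.ofReal_pow (by positivity), ← ENNReal.ofReal_mul (by positivity),
          ← ENNReal.ofReal_mul (by positivity), ← hR]
        congr 1
        have : R ^ a = (R ^ (a / 2)) ^ 2 := by
          rw [← Real.rpow_natCast, ← Real.rpow_mul (by positivity)]
          congr 1
          push_cast
          ring
        rw [this]
        ring

/-- The multiplier `⟨k⟩^{-γ} ⟨m⟩^{-α} ⟨k - m⟩^{-β}`, restricted to the region `⟨k - m⟩ ≤ ⟨m⟩`. -/
noncomputable def sobolevKernel (α β γ : ℝ) (k m : ℤ × ℤ) : ℝ≥0∞ :=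
  if 1 + latNorm (k - m) ^ 2 ≤ 1 + latNorm m ^ 2 then
    sobolevWeight (-(γ / 2)) k * sobolevWeight (-(α / 2)) m * sobolevWeight (-(β / 2)) (k - m)
  else 0

theorem sobolevKernel_sq_le {α β γ : ℝ} (hβ : 0 ≤ β) (hγ : 0 ≤ γ)
    (k m : ℤ × ℤ) :
    sobolevKernel α β γ k m ^ 2 ≤
      ENNReal.ofReal (4 ^ γ) * sobolevWeight (-(α + γ)) m *
        (if 1 + latNorm (k - m) ^ 2 ≤ 1 + latNorm m ^ 2 then sobolevWeight (-β) (k - m) else 0) +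
      ENNReal.ofReal (4 ^ β) * sobolevWeight (-(α + β)) m *
        (if 1 + latNorm k ^ 2 ≤ 1 + latNorm m ^ 2 then sobolevWeight (-γ) k else 0) := by
  rw [sobolevKernel]
  split_ifs with h₁ h₂ h₂
  any_goals simp
  all_goals
    have hm := one_add_latNorm_sq_le_add_sub k m
    rw [mul_pow, mul_pow, sobolevWeight_sq, sobolevWeight_sq, sobolevWeight_sq,
      show 2 * -(γ / 2) = -γ by ring, show 2 * -(α / 2) = -α by ring,
      show 2 * -(β / 2) = -β by ring, ← sobolevWeight_mul (-γ) (-α)]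
  · rw [← sobolevWeight_mul (-β) (-α)]
    rcases le_total (latNorm (k - m) ^ 2) (latNorm k ^ 2) with h | h
    · refine le_add_right ?_
      rw [← mul_assoc]
      gcongr
      exact sobolevWeight_neg_le hγ (by linarith)
    · refine le_add_left ?_
      calc _ ≤ sobolevWeight (-γ) k * sobolevWeight (-α) m *
            (ENNReal.ofReal (4 ^ β) * sobolevWeight (-β) m) := by
            gcongr
            exact sobolevWeight_neg_le hβ (by linarith)
        _ = _ := by ring
  · rw [← mul_assoc]
    gcongr
    exact sobolevWeight_neg_le hγ (by linarith)

theorem exists_tsum_sobolevKernel_sq_le {α β γ : ℝ} (hα : 0 ≤ α) (hβ : 0 ≤ β) (hγ : 0 ≤ γ)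
    (hsum : 1 ≤ α + β + γ) (hstrict : (α = 1 ∨ β = 1 ∨ γ = 1) → 1 < α + β + γ) :
    ∃ C : ℝ, 0 < C ∧ ∀ m, ∑' k, sobolevKernel α β γ k m ^ 2 ≤ ENNReal.ofReal C := by
  obtain ⟨C₁, hC₁, h₁⟩ := exists_tsum_sobolevWeight_neg_le (a := α + γ) (b := β) (by positivity) hβ
    (by linarith) fun h => by linarith [hstrict (.inr (.inl h))]
  obtain ⟨C₂, hC₂, h₂⟩ := exists_tsum_sobolevWeight_neg_le (a := α + β) (b := γ) (by positivity) hγ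
    (by linarith) fun h => by linarith [hstrict (.inr (.inr h))]
  refine ⟨4 ^ γ * C₁ + 4 ^ β * C₂, by positivity, fun m => ?_⟩
  refine (ENNReal.tsum_le_tsum fun k => sobolevKernel_sq_le hβ hγ k m).trans ?_
  rw [ENNReal.tsum_add, ENNReal.tsum_mul_left, ENNReal.tsum_mul_left,
    ENNReal.ofReal_add (by positivity) (by positivity), ENNReal.ofReal_mul (by positivity),
    ENNReal.ofReal_mul (by positivity)]
  have hcancel : ∀ (s : ℝ) (x y : ℝ≥0∞),
      x * sobolevWeight (-s) m * (y * sobolevWeight s m) = x * y := fun s x y => by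
    rw [mul_mul_mul_comm, sobolevWeight_mul, neg_add_cancel, sobolevWeight_zero, mul_one]
  refine add_le_add ?_ ?_
  · have hshift := (Equiv.subRight m).tsum_eq fun n : ℤ × ℤ =>
      if 1 + latNorm n ^ 2 ≤ 1 + latNorm m ^ 2 then sobolevWeight (-β) n else 0
    exact (mul_le_mul_right (hshift.trans_le (h₁ m)) _).trans_eq (hcancel _ _ _)
  · exact (mul_le_mul_right (h₂ m) _).trans_eq (hcancel _ _ _)

theorem tsum_sq_tsum_kernel_mul_le {G : Type*} [AddCommGroup G] {K : G → G → ℝ≥0∞} {C : ℝ≥0∞}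
    (hK : ∀ m, ∑' k, K k m ^ 2 ≤ C) (f g : G → ℝ≥0∞) :
    ∑' k, (∑' m, K k m * f m * g (k - m)) ^ 2 ≤ C * (∑' m, f m ^ 2) * ∑' m, g m ^ 2 := by
  calc _ ≤ ∑' k, (∑' m, (K k m * f m) ^ 2) * ∑' m, g m ^ 2 := by
        refine ENNReal.tsum_le_tsum fun k => (ENNReal.sq_tsum_mul_le _ _).trans_eq ?_
        rw [← (Equiv.subLeft k).tsum_eq fun m => g m ^ 2]
        rfl
    _ = (∑' m, (∑' k, K k m ^ 2) * f m ^ 2) * ∑' m, g m ^ 2 := by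
        rw [ENNReal.tsum_mul_right, ENNReal.tsum_comm]
        simp only [mul_pow, ENNReal.tsum_mul_right]
    _ ≤ (∑' m, C * f m ^ 2) * ∑' m, g m ^ 2 := by
        gcongr with m
        exact hK m
    _ = _ := by rw [ENNReal.tsum_mul_left]

/-- The Sobolev product estimate on the Fourier side. -/
theorem exists_tsum_sq_convolution_le {α β γ : ℝ} (hα : 0 ≤ α) (hβ : 0 ≤ β) (hγ : 0 ≤ γ)
    (hsum : 1 ≤ α + β + γ) (hstrict : (α = 1 ∨ β = 1 ∨ γ = 1) → 1 < α + β + γ) :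
    ∃ C : ℝ, 0 < C ∧ ∀ f g : ℤ × ℤ → ℝ≥0∞,
      ∑' k, (∑' m, sobolevWeight (-(γ / 2)) k * sobolevWeight (-(α / 2)) m *
        sobolevWeight (-(β / 2)) (k - m) * f m * g (k - m)) ^ 2 ≤
        ENNReal.ofReal C * (∑' m, f m ^ 2) * ∑' m, g m ^ 2 := by
  obtain ⟨C₁, hC₁, h₁⟩ := exists_tsum_sobolevKernel_sq_le hα hβ hγ hsum hstrict
  obtain ⟨C₂, hC₂, h₂⟩ := exists_tsum_sobolevKernel_sq_le hβ hα hγ (by linarith)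
    fun h => by linarith [hstrict (by tauto)]
  refine ⟨4 * (C₁ + C₂), by positivity, fun f g => ?_⟩
  have hsplit : ∀ k m, sobolevWeight (-(γ / 2)) k * sobolevWeight (-(α / 2)) m *
      sobolevWeight (-(β / 2)) (k - m) * f m * g (k - m) ≤
      sobolevKernel α β γ k m * f m * g (k - m) +
        sobolevKernel β α γ k (k - m) * g (k - m) * f (k - (k - m)) := fun k m => by
    rcases le_total (1 + latNorm (k - m) ^ 2) (1 + latNorm m ^ 2) with h | h
    · refine le_add_right ?_
      rw [sobolevKernel, if_pos h]
    · refine le_add_left ?_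
      rw [sobolevKernel, sub_sub_cancel, if_pos h]
      exact le_of_eq (by ring)
  calc _ ≤ ∑' k, 4 * ((∑' m, sobolevKernel α β γ k m * f m * g (k - m)) ^ 2 +
        (∑' n, sobolevKernel β α γ k n * g n * f (k - n)) ^ 2) := by
        refine ENNReal.tsum_le_tsum fun k => ?_
        refine le_trans ?_ (ENNReal.add_sq_le_four_mul _ _)
        rw [← (Equiv.subLeft k).tsum_eq fun n => sobolevKernel β α γ k n * g n * f (k - n),
          ← ENNReal.tsum_add]
        gcongr with m
        exact hsplit k m
    _ ≤ 4 * (ENNReal.ofReal C₁ * (∑' m, f m ^ 2) * (∑' m, g m ^ 2) +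
        ENNReal.ofReal C₂ * (∑' m, g m ^ 2) * ∑' m, f m ^ 2) := by
        rw [ENNReal.tsum_mul_left, ENNReal.tsum_add]
        gcongr
        · exact tsum_sq_tsum_kernel_mul_le h₁ f g
        · exact tsum_sq_tsum_kernel_mul_le h₂ g f
    _ = _ := by
        rw [ENNReal.ofReal_mul (by norm_num), ENNReal.ofReal_add hC₁.le hC₂.le, ENNReal.ofReal_ofNat]
        ring

theorem HNorm_eq (s : ℝ) (u : ℤ × ℤ → ℂ) :
    HNorm s u = (∑' k, (sobolevWeight (s / 2) k * ‖u k‖ₑ) ^ 2) ^ (1 / 2 : ℝ) := by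
  rw [HNorm]
  congr 2 with k
  have := one_add_latNorm_sq_pos k
  rw [mul_pow, sobolevWeight_sq, mul_div_cancel₀ s two_ne_zero, sobolevWeight,
    ENNReal.ofReal_mul (by positivity), ENNReal.ofReal_pow (norm_nonneg _), ofReal_norm]

/-- The pairs of lattice points with sum `k`, parametrized by their first component. -/
def equivSumEq (k : ℤ × ℤ) : ℤ × ℤ ≃ {p : (ℤ × ℤ) × (ℤ × ℤ) // p.1 + p.2 = k} where
  toFun m := ⟨(m, k - m), add_sub_cancel m k⟩
  invFun p := p.1.1
  left_inv _ := rfl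
  right_inv := by
    rintro ⟨⟨m, n⟩, rfl⟩
    simp

theorem enorm_dot_le (m n : ℤ × ℤ) :
    ‖(((m.1 : ℝ) * n.1 + (m.2 : ℝ) * n.2 : ℝ) : ℂ)‖ₑ ≤
      sobolevWeight (1 / 2) m * sobolevWeight (1 / 2) n := by
  have hm := one_add_latNorm_sq_pos m
  have hn := one_add_latNorm_sq_pos n
  rw [← ofReal_norm, Complex.norm_real, sobolevWeight, sobolevWeight,
    ← ENNReal.ofReal_mul (by positivity), ← Real.mul_rpow hm.le hn.le, ← Real.sqrt_eq_rpow]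
  refine ENNReal.ofReal_le_ofReal (Real.abs_le_sqrt ?_)
  rw [latNorm_sq, latNorm_sq]
  nlinarith [sq_nonneg ((m.1 : ℝ) * n.2 - m.2 * n.1), sq_nonneg (m.1 : ℝ), sq_nonneg (m.2 : ℝ),
    sq_nonneg (n.1 : ℝ), sq_nonneg (n.2 : ℝ)]

theorem enorm_latNorm_sq_le (k : ℤ × ℤ) :
    ‖-((latNorm k ^ 2 : ℝ) : ℂ)‖ₑ ≤ sobolevWeight 1 k := by
  rw [enorm_neg, ← ofReal_norm, Complex.norm_real, sobolevWeight, Real.rpow_one,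
    Real.norm_of_nonneg (sq_nonneg _)]
  exact ENNReal.ofReal_le_ofReal (by linarith)

theorem enorm_Bcoef_le (u v : ℤ × ℤ → ℂ) (k : ℤ × ℤ) :
    ‖Bcoef u v k‖ₑ ≤ sobolevWeight 1 k * ∑' m,
      sobolevWeight (1 / 2) m * sobolevWeight (1 / 2) (k - m) * ‖u m‖ₑ * ‖v (k - m)‖ₑ := by
  rw [Bcoef, enorm_mul]
  refine mul_le_mul' (enorm_latNorm_sq_le k) (enorm_tsum_le_tsum_enorm.trans ?_)
  rw [← (equivSumEq k).tsum_eq]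
  refine ENNReal.tsum_le_tsum fun m => ?_
  rw [enorm_mul, enorm_mul]
  exact mul_le_mul_left (mul_le_mul_left (enorm_dot_le m (k - m)) _) _

/-- The bilinear map `B(u₁,u₂) = Δ(∇u₁·∇u₂)` maps `H^{1+α} × H^{1+β}` continuously
into `H^{-2-γ}` whenever `α + β + γ ≥ 1` (with strict inequality if one of the
exponents equals `1`). -/
theorem B_continuous_Sobolev (α β γ : ℝ) (hα : 0 ≤ α) (hβ : 0 ≤ β) (hγ : 0 ≤ γ)
    (hsum : 1 ≤ α + β + γ)
    (hstrict : (α = 1 ∨ β = 1 ∨ γ = 1) → 1 < α + β + γ) :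
    ∃ c : ℝ, 0 < c ∧ ∀ u v : ℤ × ℤ → ℂ,
      HNorm (-2 - γ) (Bcoef u v) ≤
        ENNReal.ofReal c * HNorm (1 + α) u * HNorm (1 + β) v := by
  obtain ⟨C, hC, h⟩ := exists_tsum_sq_convolution_le hα hβ hγ hsum hstrict
  refine ⟨C ^ (1 / 2 : ℝ), by positivity, fun u v => ?_⟩
  rw [HNorm_eq, HNorm_eq, HNorm_eq, ← ENNReal.ofReal_rpow_of_pos hC,
    ← ENNReal.mul_rpow_of_nonneg _ _ (by norm_num), ← ENNReal.mul_rpow_of_nonneg _ _ (by norm_num)]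
  refine ENNReal.rpow_le_rpow (le_trans ?_ (h _ _)) (by norm_num)
  gcongr with k
  calc _ ≤ sobolevWeight ((-2 - γ) / 2) k * (sobolevWeight 1 k * ∑' m,
        sobolevWeight (1 / 2) m * sobolevWeight (1 / 2) (k - m) * ‖u m‖ₑ * ‖v (k - m)‖ₑ) := by
        gcongr
        exact enorm_Bcoef_le u v k
    _ = ∑' m, sobolevWeight (-(γ / 2)) k *
        (sobolevWeight (1 / 2) m * sobolevWeight (1 / 2) (k - m) * ‖u m‖ₑ * ‖v (k - m)‖ₑ) := by
        rw [← mul_assoc, sobolevWeight_mul, ENNReal.tsum_mul_left]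
        congr 2
        ring
    _ = _ := by
        refine tsum_congr fun m => ?_
        rw [show (1 / 2 : ℝ) = -(α / 2) + (1 + α) / 2 by ring, ← sobolevWeight_mul,
          show -(α / 2) + (1 + α) / 2 = -(β / 2) + (1 + β) / 2 by ring, ← sobolevWeight_mul]
        ring
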